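/- Let q be a prime, a ≥ 1, and let E be an extraspecial group of order q^(1+2a). Set d = q^a. Then the group Aut_c(E) of automorphisms of E fixing the center of E pointwise satisfies |Aut_c(E)| ≤ N(d,q), and the full automorphism group satisfies |Aut(E)| ≤ (q−1)·N(d,q), where N(d,q) = d^(2·log₃ d + 3) if q ≠ 2, N(d,q) = 2·d^(2·log₂ d + 1) if q = 2 and d > 2, and N(d,q) = 24 if q = 2 and d = 2. -/

import Mathlib

/-- `E` is an extraspecial group of order `q^(1+2a)`: its order is `q^(1+2a)`, its center
has order `q`, and the center equals the commutator subgroup. -/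
def IsExtraspecial (q a : ℕ) (E : Type*) [Group E] : Prop :=
  Nat.card E = q ^ (1 + 2 * a) ∧ Nat.card (Subgroup.center E) = q ∧
    Subgroup.center E = commutator E

/-- The group `Aut_c(E)` of automorphisms of `E` fixing the center of `E` pointwise,
as a subgroup of `Aut(E)`. -/
def centralAutomorphisms (E : Type*) [Group E] : Subgroup (MulAut E) where
  carrier := {f | ∀ x ∈ Subgroup.center E, f x = x}
  one_mem' := fun _ _ => rfl
  mul_mem' := by
    intro f g hf hg x hx
    show f (g x) = x
    rw [hg x hx, hf x hx]
  inv_mem' := by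
    intro f hf x hx
    have h := hf x hx
    show f.symm x = x
    conv_lhs => rw [← h]
    exact f.symm_apply_apply x

/-- The bound `N(d,q)`: `d^(2·log₃ d + 3)` if `q ≠ 2`; `2·d^(2·log₂ d + 1)` if `q = 2`
and `d > 2`; and `24` if `q = 2` and `d = 2`. -/
noncomputable def NBound (d q : ℕ) : ℝ :=
  if q ≠ 2 then (d : ℝ) ^ (2 * Real.logb 3 d + 3)
  else if 2 < d then 2 * (d : ℝ) ^ (2 * Real.logb 2 d + 1)
  else 24

open scoped commutatorElement
/-- `G` is a group of order `q^(1+2m)` with center of order `q` containing all commutators. -/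
structure IsSpecialOfRank (q m : ℕ) (G : Type*) [Group G] : Prop where
  card : Nat.card G = q ^ (1 + 2 * m)
  card_center : Nat.card (Subgroup.center G) = q
  commutator_mem : ∀ x y : G, ⁅x, y⁆ ∈ Subgroup.center G

namespace IsSpecialOfRank

variable {q m : ℕ} {G : Type*} [Group G]

theorem finite (hG : IsSpecialOfRank q m G) (hq : q.Prime) : Finite G :=
  Nat.finite_of_card_ne_zero (by rw [hG.card]; exact pow_ne_zero _ hq.ne_zero)

/-- The homomorphism `y ↦ ⁅e, y⁆` into the center. -/
def commHom (hG : IsSpecialOfRank q m G) (e : G) : G →* Subgroup.center G where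
  toFun y := ⟨⁅e, y⁆, hG.commutator_mem e y⟩
  map_one' := by ext; simp
  map_mul' x y := by
    ext
    have h := (Subgroup.mem_center_iff.mp (hG.commutator_mem e y)) x
    simp only [commutatorElement_def] at h ⊢
    calc e * (x * y) * e⁻¹ * (x * y)⁻¹
        = e * x * e⁻¹ * (e * y * e⁻¹ * y⁻¹) * x⁻¹ := by group
      _ = e * x * e⁻¹ * x⁻¹ * (x * (e * y * e⁻¹ * y⁻¹)) * x⁻¹ := by group
      _ = e * x * e⁻¹ * x⁻¹ * (e * y * e⁻¹ * y⁻¹) := by rw [h]; group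

@[simp]
theorem coe_commHom (hG : IsSpecialOfRank q m G) (e y : G) : (hG.commHom e y : G) = ⁅e, y⁆ := rfl

theorem exists_zpow (hG : IsSpecialOfRank q m G) (hq : q.Prime) {e₁ e₂ : G} (he : ⁅e₁, e₂⁆ ≠ 1)
    (u v : Subgroup.center G) :
    ∃ i j : ℤ, hG.commHom e₁ (e₁ ^ i * e₂ ^ j) = u ∧ hG.commHom e₂ (e₁ ^ i * e₂ ^ j) = v := by
  have : Fact q.Prime := ⟨hq⟩
  set z := hG.commHom e₁ e₂ with hz
  have hz1 : z ≠ 1 := fun h => he (by simpa [hz] using congrArg Subtype.val h)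
  have htop := zpowers_eq_top_of_prime_card hG.card_center hz1
  obtain ⟨k, rfl⟩ : u ∈ Subgroup.zpowers z := htop ▸ Subgroup.mem_top u
  obtain ⟨l, rfl⟩ : v ∈ Subgroup.zpowers z := htop ▸ Subgroup.mem_top v
  have h11 : hG.commHom e₁ e₁ = 1 := by ext; simp
  have h22 : hG.commHom e₂ e₂ = 1 := by ext; simp
  have h21 : hG.commHom e₂ e₁ = z⁻¹ := by ext; simp [hz]
  refine ⟨-l, k, ?_, ?_⟩
  · simp [h11, ← hz]
  · simp [h21, h22]

theorem mem_centralizer_pair_iff {e₁ e₂ x : G} :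
    x ∈ Subgroup.centralizer {e₁, e₂} ↔ ⁅e₁, x⁆ = 1 ∧ ⁅e₂, x⁆ = 1 := by
  simp [Subgroup.mem_centralizer_iff, commutatorElement_eq_one_iff_mul_comm]

theorem exists_zpow_mul (hG : IsSpecialOfRank q m G) (hq : q.Prime) {e₁ e₂ : G}
    (he : ⁅e₁, e₂⁆ ≠ 1) (g : G) :
    ∃ i j : ℤ, ∃ c ∈ Subgroup.centralizer {e₁, e₂}, g = e₁ ^ i * e₂ ^ j * c := by
  obtain ⟨i, j, h₁, h₂⟩ := hG.exists_zpow hq he (hG.commHom e₁ g) (hG.commHom e₂ g)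
  refine ⟨i, j, (e₁ ^ i * e₂ ^ j)⁻¹ * g, mem_centralizer_pair_iff.mpr ⟨?_, ?_⟩, by group⟩
  · rw [← hG.coe_commHom, map_mul, map_inv, h₁]; simp
  · rw [← hG.coe_commHom, map_mul, map_inv, h₂]; simp

theorem mem_center_of_mem_center_centralizer (hG : IsSpecialOfRank q m G) (hq : q.Prime)
    {e₁ e₂ : G} (he : ⁅e₁, e₂⁆ ≠ 1) {c : Subgroup.centralizer {e₁, e₂}} :
    c ∈ Subgroup.center (Subgroup.centralizer {e₁, e₂}) ↔ (c : G) ∈ Subgroup.center G := by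
  simp only [Subgroup.mem_center_iff]
  refine ⟨fun h g => ?_, fun h g => Subtype.ext (h g)⟩
  obtain ⟨i, j, x, hx, rfl⟩ := hG.exists_zpow_mul hq he g
  obtain ⟨h₁, h₂⟩ := mem_centralizer_pair_iff.mp c.2
  rw [commutatorElement_eq_one_iff_commute] at h₁ h₂
  have h₃ : Commute x (c : G) := congrArg Subtype.val (h ⟨x, hx⟩)
  exact ((h₁.zpow_left i).mul_left (h₂.zpow_left j)).mul_left h₃

theorem centralizer_pair (hG : IsSpecialOfRank q (m + 1) G) (hq : q.Prime) {e₁ e₂ : G}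
    (he : ⁅e₁, e₂⁆ ≠ 1) : IsSpecialOfRank q m (Subgroup.centralizer {e₁, e₂}) where
  card := by
    have hker : ((hG.commHom e₁).prod (hG.commHom e₂)).ker = Subgroup.centralizer {e₁, e₂} := by
      ext x
      rw [mem_centralizer_pair_iff, MonoidHom.mem_ker]
      simp [Prod.ext_iff, Subtype.ext_iff]
    have hsurj : Function.Surjective ((hG.commHom e₁).prod (hG.commHom e₂)) := by
      rintro ⟨u, v⟩
      obtain ⟨i, j, h₁, h₂⟩ := hG.exists_zpow hq he u v
      exact ⟨_, Prod.ext h₁ h₂⟩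
    have h := Subgroup.card_mul_index (Subgroup.centralizer {e₁, e₂})
    rw [← hker, Subgroup.index_ker, MonoidHom.range_eq_top.mpr hsurj, Subgroup.card_top,
      Nat.card_prod, hG.card_center, hG.card, hker] at h
    have hq2 : 0 < q * q := Nat.mul_pos hq.pos hq.pos
    refine Nat.eq_of_mul_eq_mul_right hq2 (h.trans ?_)
    ring
  card_center := by
    rw [← hG.card_center]
    refine Nat.card_congr ⟨fun c => ⟨c.1, ?_⟩, fun z => ⟨⟨z, ?_⟩, ?_⟩, fun _ => rfl, fun _ => rfl⟩
    · exact (hG.mem_center_of_mem_center_centralizer hq he).mp c.2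
    · exact Subgroup.center_le_centralizer _ z.2
    · exact (hG.mem_center_of_mem_center_centralizer hq he).mpr z.2
  commutator_mem x y :=
    (hG.mem_center_of_mem_center_centralizer hq he).mpr (hG.commutator_mem x y)

theorem map_commutator {f : MulAut G} (hG : IsSpecialOfRank q m G)
    (hf : f ∈ centralAutomorphisms G) (x y : G) : ⁅f x, f y⁆ = ⁅x, y⁆ := by
  rw [← map_commutatorElement, hf _ (hG.commutator_mem x y)]

theorem finite_mulAut [Finite G] : Finite (MulAut G) :=
  Finite.of_injective (fun f : MulAut G => (f : G → G)) DFunLike.coe_injective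

/-- The restriction to a subgroup of an automorphism that, with its inverse, preserves it. -/
def restrictEquiv (C : Subgroup G) (f : MulAut G) (h : ∀ c, f c ∈ C ↔ c ∈ C) : MulAut C where
  toFun c := ⟨f c, (h c).mpr c.2⟩
  invFun c := ⟨f.symm c, (h _).mp (by simp)⟩
  left_inv c := by ext; simp
  right_inv c := by ext; simp
  map_mul' x y := by ext; simp

theorem card_le (hG : IsSpecialOfRank q m G) (hq : q.Prime) {e₁ e₂ : G}
    (he : ⁅e₁, e₂⁆ ≠ 1) (P : Set (G × G)) (hP : ∀ f ∈ centralAutomorphisms G, (f e₁, f e₂) ∈ P) :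
    Nat.card (centralAutomorphisms G) ≤
      Nat.card P * Nat.card (centralAutomorphisms (Subgroup.centralizer {e₁, e₂})) := by
  have := hG.finite hq
  have : Finite (MulAut G) := finite_mulAut
  have : Finite (MulAut (Subgroup.centralizer {e₁, e₂})) := finite_mulAut
  rw [← Nat.card_congr
    (MulAction.orbitProdStabilizerEquivGroup (centralAutomorphisms G) (e₁, e₂)), Nat.card_prod]
  refine Nat.mul_le_mul (Nat.card_mono (Set.toFinite P) ?_) ?_
  · rintro _ ⟨f, rfl⟩
    exact hP f f.2
  · have hstab (f : MulAction.stabilizer (centralAutomorphisms G) (e₁, e₂)) :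
        f.1.1 e₁ = e₁ ∧ f.1.1 e₂ = e₂ := Prod.ext_iff.mp f.2
    have hmem (f : MulAction.stabilizer (centralAutomorphisms G) (e₁, e₂)) (c : G) :
        f.1.1 c ∈ Subgroup.centralizer {e₁, e₂} ↔ c ∈ Subgroup.centralizer {e₁, e₂} := by
      have h₁ := hG.map_commutator f.1.2 e₁ c
      have h₂ := hG.map_commutator f.1.2 e₂ c
      rw [(hstab f).1] at h₁
      rw [(hstab f).2] at h₂
      rw [mem_centralizer_pair_iff, mem_centralizer_pair_iff, h₁, h₂]
    refine Nat.card_le_card_of_injective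
      (fun f => ⟨restrictEquiv _ f.1.1 (hmem f), fun c hc => Subtype.ext
        (f.1.2 c ((hG.mem_center_of_mem_center_centralizer hq he).mp hc))⟩) ?_
    intro f g hfg
    ext x
    obtain ⟨i, j, c, hc, rfl⟩ := hG.exists_zpow_mul hq he x
    have h : f.1.1 c = g.1.1 c :=
      congrArg Subtype.val (DFunLike.congr_fun (congrArg Subtype.val hfg)
        (⟨c, hc⟩ : Subgroup.centralizer {e₁, e₂}))
    simp [hstab, h]

theorem exists_commutator_ne_one {e : G}
    (he : e ∉ Subgroup.center G) : ∃ e' : G, ⁅e, e'⁆ ≠ 1 := by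
  by_contra! h
  refine he (Subgroup.mem_center_iff.mpr fun g => ?_)
  exact (commutatorElement_eq_one_iff_mul_comm.mp (h g)).symm

theorem exists_notMem_center (hG : IsSpecialOfRank q (m + 1) G) (hq : q.Prime) :
    ∃ e : G, e ∉ Subgroup.center G := by
  by_contra! h
  have htop : Subgroup.center G = ⊤ := (Subgroup.eq_top_iff' _).mpr h
  have h1 := hG.card_center
  rw [htop, Subgroup.card_top, hG.card] at h1
  have := Nat.pow_right_injective hq.two_le (h1.trans (pow_one q).symm)
  omega

theorem card_zero (hG : IsSpecialOfRank q 0 G) (hq : q.Prime) :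
    Nat.card (centralAutomorphisms G) = 1 := by
  have := hG.finite hq
  have htop : Subgroup.center G = ⊤ :=
    Subgroup.eq_top_of_card_eq _ (by rw [hG.card_center, hG.card]; ring)
  have : Subsingleton (centralAutomorphisms G) :=
    ⟨fun f g => Subtype.ext (MulEquiv.ext fun x => by
      rw [f.2 x (htop ▸ Subgroup.mem_top x), g.2 x (htop ▸ Subgroup.mem_top x)])⟩
  exact Nat.card_unique

theorem card_fiber (hG : IsSpecialOfRank q m G) (hq : q.Prime) {e : G}
    (he : e ∉ Subgroup.center G) (z : Subgroup.center G) :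
    Nat.card {y : G // ⁅e, y⁆ = z} = q ^ (2 * m) := by
  have := hG.finite hq
  obtain ⟨e', he'⟩ := exists_commutator_ne_one he
  have hsurj : Function.Surjective (hG.commHom e) := fun u => by
    obtain ⟨i, j, h, -⟩ := hG.exists_zpow hq he' u 1
    exact ⟨_, h⟩
  have h := Subgroup.card_mul_index (hG.commHom e).ker
  rw [Subgroup.index_ker, MonoidHom.range_eq_top.mpr hsurj, Subgroup.card_top, hG.card_center,
    hG.card, pow_add, pow_one, mul_comm] at h
  rw [← Nat.eq_of_mul_eq_mul_left hq.pos h]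
  obtain ⟨y₀, rfl⟩ := hsurj z
  refine Nat.card_congr ((Equiv.mulLeft y₀⁻¹).subtypeEquiv fun y => ?_)
  rw [Equiv.coe_mulLeft, MonoidHom.mem_ker, map_mul, map_inv, inv_mul_eq_one, Subtype.ext_iff,
    eq_comm]
  rfl

theorem card_pairs (hG : IsSpecialOfRank q m G) (hq : q.Prime) (z : Subgroup.center G) :
    Nat.card {p : G × G | p.1 ∉ Subgroup.center G ∧ ⁅p.1, p.2⁆ = z} =
      (q ^ (1 + 2 * m) - q) * q ^ (2 * m) := by
  classical
  have := hG.finite hq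
  have e : {p : G × G | p.1 ∉ Subgroup.center G ∧ ⁅p.1, p.2⁆ = z} ≃
      Σ x : {x : G // x ∉ Subgroup.center G}, {y : G // ⁅x.1, y⁆ = z} :=
    ⟨fun p => ⟨⟨p.1.1, p.2.1⟩, ⟨p.1.2, p.2.2⟩⟩, fun s => ⟨(s.1.1, s.2.1), s.1.2, s.2.2⟩,
      fun _ => rfl, fun _ => rfl⟩
  cases nonempty_fintype G
  rw [Nat.card_congr e, Nat.card_sigma, Finset.sum_congr rfl fun x _ => hG.card_fiber hq x.2 z,
    Finset.sum_const, Finset.card_univ, smul_eq_mul, Fintype.card_subtype_compl,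
    ← Nat.card_eq_fintype_card, ← Nat.card_eq_fintype_card, hG.card]
  congr 2
  exact hG.card_center

theorem card_succ_le (hG : IsSpecialOfRank q (m + 1) G) (hq : q.Prime) {e₁ e₂ : G}
    (he : ⁅e₁, e₂⁆ ≠ 1) : Nat.card (centralAutomorphisms G) ≤
      (q ^ (1 + 2 * (m + 1)) - q) * q ^ (2 * (m + 1)) *
        Nat.card (centralAutomorphisms (Subgroup.centralizer {e₁, e₂})) := by
  rw [← hG.card_pairs hq (hG.commHom e₁ e₂)]
  refine hG.card_le hq he _ fun f hf => ⟨fun h => he ?_, hG.map_commutator hf e₁ e₂⟩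
  rw [← hG.map_commutator hf]
  exact commutatorElement_eq_one_iff_mul_comm.mpr (Subgroup.mem_center_iff.mp h _).symm

theorem card_centralAutomorphisms_le {q : ℕ} (hq : q.Prime) (m : ℕ) :
    ∀ (G : Type*) [Group G], IsSpecialOfRank q m G →
      Nat.card (centralAutomorphisms G) ≤ q ^ (m * (2 * m + 3)) := by
  induction m with
  | zero => intro G _ hG; simp [hG.card_zero hq]
  | succ m ih =>
    intro G _ hG
    obtain ⟨e₁, h₁⟩ := hG.exists_notMem_center hq
    obtain ⟨e₂, he⟩ := exists_commutator_ne_one h₁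
    calc Nat.card (centralAutomorphisms G)
        ≤ q ^ (1 + 2 * (m + 1)) * q ^ (2 * (m + 1)) * q ^ (m * (2 * m + 3)) :=
          (hG.card_succ_le hq he).trans (Nat.mul_le_mul
            (Nat.mul_le_mul_right _ (Nat.sub_le _ _)) (ih _ (hG.centralizer_pair hq he)))
      _ = q ^ ((m + 1) * (2 * (m + 1) + 3)) := by ring

end IsSpecialOfRank

/-! ### Counting square roots when the center has order two -/

open scoped Classical in
/-- The sign of a group element: `1` at the identity and `-1` elsewhere. -/
noncomputable def groupSign {G : Type*} [Group G] (g : G) : ℤ := if g = 1 then 1 else -1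

/-- The difference between the number of `x` with `x ^ 2 = 1` and the number of those without. -/
noncomputable def signSum (G : Type*) [Group G] : ℤ := ∑ᶠ x : G, groupSign (x ^ 2)

namespace IsSpecialOfRank

variable {m : ℕ} {G : Type*} [Group G]

theorem groupSign_one : groupSign (1 : G) = 1 := by simp [groupSign]

theorem groupSign_ne {g : G} (h : g ≠ 1) : groupSign g = -1 := by simp [groupSign, h]

theorem groupSign_mul_self (g : G) : groupSign g * groupSign g = 1 := by
  by_cases h : g = 1 <;> simp [groupSign, h]

theorem groupSign_inv (g : G) : groupSign g⁻¹ = groupSign g := by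
  by_cases h : g = 1 <;> simp [groupSign, h]

theorem sq_eq_one_of_mem_center (hG : IsSpecialOfRank 2 m G) {x : G}
    (hx : x ∈ Subgroup.center G) : x ^ 2 = 1 := by
  have h : (⟨x, hx⟩ : Subgroup.center G) ^ Nat.card (Subgroup.center G) = 1 := pow_card_eq_one'
  rw [hG.card_center] at h
  exact congrArg Subtype.val h

theorem eq_of_mem_center (hG : IsSpecialOfRank 2 m G) {x y : G} (hx : x ∈ Subgroup.center G)
    (hy : y ∈ Subgroup.center G) (hx1 : x ≠ 1) (hy1 : y ≠ 1) : x = y := by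
  obtain ⟨z, -, h⟩ := (Nat.card_eq_two_iff' (1 : Subgroup.center G)).mp hG.card_center
  have h₁ := h ⟨x, hx⟩ fun h => hx1 (congrArg Subtype.val h)
  have h₂ := h ⟨y, hy⟩ fun h => hy1 (congrArg Subtype.val h)
  exact congrArg Subtype.val (h₁.trans h₂.symm)

theorem groupSign_mul (hG : IsSpecialOfRank 2 m G) {x y : G} (hx : x ∈ Subgroup.center G)
    (hy : y ∈ Subgroup.center G) : groupSign (x * y) = groupSign x * groupSign y := by
  by_cases hx1 : x = 1
  · simp [hx1, groupSign_one]
  by_cases hy1 : y = 1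
  · simp [hy1, groupSign_one]
  rw [hG.eq_of_mem_center hx hy hx1 hy1, ← pow_two, hG.sq_eq_one_of_mem_center hy,
    groupSign_mul_self, groupSign_one]

theorem sq_mem_center (hG : IsSpecialOfRank 2 m G) (x : G) : x ^ 2 ∈ Subgroup.center G := by
  refine Subgroup.mem_center_iff.mpr fun y => ?_
  rw [← commutatorElement_eq_one_iff_mul_comm, ← hG.coe_commHom, map_pow]
  exact hG.sq_eq_one_of_mem_center (hG.commutator_mem y x)

theorem groupSign_comm (x y : G) : groupSign ⁅x, y⁆ = groupSign ⁅y, x⁆ := by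
  rw [← commutatorElement_inv, groupSign_inv]

theorem groupSign_commutator_mul (hG : IsSpecialOfRank 2 m G) (e x y : G) :
    groupSign ⁅e, x * y⁆ = groupSign ⁅e, x⁆ * groupSign ⁅e, y⁆ := by
  rw [← hG.groupSign_mul (hG.commutator_mem e x) (hG.commutator_mem e y), ← hG.coe_commHom,
    map_mul]
  rfl

theorem groupSign_mul_sq (hG : IsSpecialOfRank 2 m G) (x y : G) :
    groupSign ((x * y) ^ 2) = groupSign (x ^ 2) * groupSign (y ^ 2) * groupSign ⁅x, y⁆ := by
  have h : (x * y) ^ 2 = x ^ 2 * y ^ 2 * ⁅y, x⁆ := by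
    have h₁ := Subgroup.mem_center_iff.mp (hG.commutator_mem y x)
    calc (x * y) ^ 2 = x * ⁅y, x⁆ * (x * y * y) := by
          simp only [commutatorElement_def, pow_two]; group
      _ = ⁅y, x⁆ * (x ^ 2 * y ^ 2) := by rw [h₁]; simp only [pow_two, mul_assoc]
      _ = _ := (h₁ _).symm
  rw [h, hG.groupSign_mul (mul_mem (hG.sq_mem_center x) (hG.sq_mem_center y))
    (hG.commutator_mem y x), hG.groupSign_mul (hG.sq_mem_center x) (hG.sq_mem_center y),
    groupSign_comm]

theorem groupSign_commutator_of_mem_center {e : G} (he : e ∈ Subgroup.center G) (x : G) :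
    groupSign ⁅e, x⁆ = 1 := by
  rw [commutatorElement_eq_one_iff_mul_comm.mpr (Subgroup.mem_center_iff.mp he x).symm,
    groupSign_one]

theorem signSum_eq_sum [Fintype G] : signSum G = ∑ x : G, groupSign (x ^ 2) :=
  finsum_eq_sum_of_fintype _

theorem sum_mulLeft [Fintype G] (e : G) (f : G → ℤ) : ∑ x, f (e * x) = ∑ x, f x :=
  Equiv.sum_comp (Equiv.mulLeft e) f

theorem sum_groupSign_commutator [Fintype G] (hG : IsSpecialOfRank 2 m G) {e : G}
    (he : e ∉ Subgroup.center G) : ∑ x : G, groupSign ⁅e, x⁆ = 0 := by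
  obtain ⟨w, hw⟩ := exists_commutator_ne_one he
  have h := sum_mulLeft w fun x => groupSign ⁅e, x⁆
  simp only [hG.groupSign_commutator_mul, groupSign_ne hw, neg_one_mul,
    Finset.sum_neg_distrib] at h
  omega

theorem sum_sq_mul_commutator [Fintype G] (hG : IsSpecialOfRank 2 m G) {e : G} (he : e ^ 2 = 1) :
    ∑ x : G, groupSign (x ^ 2) * groupSign ⁅e, x⁆ = signSum G := by
  rw [signSum_eq_sum, ← sum_mulLeft e fun x => groupSign (x ^ 2)]
  simp only [hG.groupSign_mul_sq, he, groupSign_one, one_mul]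

theorem signSum_sq (hG : IsSpecialOfRank 2 m G) : signSum G ^ 2 = (2 ^ (m + 1)) ^ 2 := by
  classical
  have := hG.finite Nat.prime_two
  cases nonempty_fintype G
  have hy (y : G) : groupSign (y ^ 2) * ∑ x : G, groupSign ⁅y, x⁆ =
      if y ∈ Subgroup.center G then (Nat.card G : ℤ) else 0 := by
    split_ifs with h
    · simp [groupSign_commutator_of_mem_center h, hG.sq_eq_one_of_mem_center h, groupSign_one]
    · rw [hG.sum_groupSign_commutator h, mul_zero]
  have hZ : Fintype.card {y : G // y ∈ Subgroup.center G} = 2 := by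
    rw [← Nat.card_eq_fintype_card]; exact hG.card_center
  calc signSum G ^ 2 = ∑ x : G, ∑ y : G, groupSign (x ^ 2) * groupSign ((x * y) ^ 2) := by
        simp only [← Finset.mul_sum, sum_mulLeft _ fun y : G => groupSign (y ^ 2)]
        rw [← Finset.sum_mul, ← signSum_eq_sum, pow_two]
    _ = ∑ x : G, ∑ y : G, groupSign (y ^ 2) * groupSign ⁅y, x⁆ := by
        refine Finset.sum_congr rfl fun x _ => Finset.sum_congr rfl fun y _ => ?_
        rw [hG.groupSign_mul_sq, groupSign_comm y x]
        linear_combination (groupSign (y ^ 2) * groupSign ⁅x, y⁆) * groupSign_mul_self (x ^ 2)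
    _ = ∑ y : G, groupSign (y ^ 2) * ∑ x : G, groupSign ⁅y, x⁆ := by
        rw [Finset.sum_comm]; simp only [Finset.mul_sum]
    _ = (2 ^ (m + 1)) ^ 2 := by
        simp only [hy]
        rw [← Finset.sum_filter, Finset.sum_const, ← Fintype.card_subtype, hZ, hG.card]
        push_cast
        ring

theorem signSum_eq (hG : IsSpecialOfRank 2 m G) :
    signSum G = 2 ^ (m + 1) ∨ signSum G = -2 ^ (m + 1) :=
  sq_eq_sq_iff_eq_or_eq_neg.mp hG.signSum_sq

theorem signSum_centralizer_pair (hG : IsSpecialOfRank 2 m G) {e₁ e₂ : G}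
    (h₁ : e₁ ^ 2 = 1) (he : ⁅e₁, e₂⁆ ≠ 1) :
    signSum G = 2 * signSum (Subgroup.centralizer {e₁, e₂}) := by
  classical
  have := hG.finite Nat.prime_two
  cases nonempty_fintype G
  have hC : 4 * signSum (Subgroup.centralizer {e₁, e₂}) =
      ∑ x : G, groupSign (x ^ 2) * (1 + groupSign ⁅e₁, x⁆) * (1 + groupSign ⁅e₂, x⁆) := by
    have hx (x : G) : groupSign (x ^ 2) * (1 + groupSign ⁅e₁, x⁆) * (1 + groupSign ⁅e₂, x⁆) =
        if x ∈ Subgroup.centralizer {e₁, e₂} then 4 * groupSign (x ^ 2) else 0 := by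
      rw [mem_centralizer_pair_iff]
      by_cases h₁ : ⁅e₁, x⁆ = 1 <;> by_cases h₂ : ⁅e₂, x⁆ = 1 <;>
        simp [h₁, h₂, groupSign_one, groupSign_ne]
      ring
    rw [Finset.sum_congr rfl fun x _ => hx x, ← Finset.sum_filter, ← Finset.mul_sum,
      signSum_eq_sum, Finset.sum_subtype (p := (· ∈ Subgroup.centralizer {e₁, e₂})) _ (by simp)]
    congr 1
    refine Finset.sum_congr rfl fun x _ => ?_
    simp [groupSign, Subtype.ext_iff]
  have hodd : ∑ x : G, groupSign (x ^ 2) * (1 + groupSign ⁅e₁, x⁆) * groupSign ⁅e₂, x⁆ = 0 := by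
    have h := sum_mulLeft e₁ fun x =>
      groupSign (x ^ 2) * (1 + groupSign ⁅e₁, x⁆) * groupSign ⁅e₂, x⁆
    have hx (x : G) : groupSign ((e₁ * x) ^ 2) * (1 + groupSign ⁅e₁, e₁ * x⁆) *
        groupSign ⁅e₂, e₁ * x⁆ =
          -(groupSign (x ^ 2) * (1 + groupSign ⁅e₁, x⁆) * groupSign ⁅e₂, x⁆) := by
      rw [hG.groupSign_mul_sq, hG.groupSign_commutator_mul, hG.groupSign_commutator_mul, h₁,
        groupSign_comm e₂ e₁, groupSign_ne he, commutatorElement_self, groupSign_one]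
      linear_combination (-groupSign (x ^ 2) * groupSign ⁅e₂, x⁆) * groupSign_mul_self ⁅e₁, x⁆
    rw [Finset.sum_congr rfl fun x _ => hx x, Finset.sum_neg_distrib] at h
    omega
  simp only [mul_add, mul_one, Finset.sum_add_distrib, add_mul] at hC hodd
  rw [hG.sum_sq_mul_commutator h₁, ← signSum_eq_sum] at hC
  linarith

theorem card_noncentral_involutions (hG : IsSpecialOfRank 2 m G) :
    2 * (Nat.card {x : G // x ∉ Subgroup.center G ∧ x ^ 2 = 1} : ℤ) =
      2 ^ (1 + 2 * m) + signSum G - 4 := by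
  classical
  have := hG.finite Nat.prime_two
  cases nonempty_fintype G
  have hZ : Fintype.card {y : G // y ∈ Subgroup.center G} = 2 := by
    rw [← Nat.card_eq_fintype_card]; exact hG.card_center
  have hx (x : G) : (if x ∉ Subgroup.center G ∧ x ^ 2 = 1 then (2 : ℤ) else 0) =
      1 + groupSign (x ^ 2) - if x ∈ Subgroup.center G then 2 else 0 := by
    by_cases h : x ∈ Subgroup.center G
    · simp [h, hG.sq_eq_one_of_mem_center h, groupSign_one]
    · by_cases h' : x ^ 2 = 1 <;> simp [h, h', groupSign_one, groupSign_ne]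
  have hsum := Finset.sum_congr (rfl : (Finset.univ : Finset G) = _) fun x _ => hx x
  rw [← Finset.sum_filter, Finset.sum_sub_distrib, ← Finset.sum_filter, Finset.sum_add_distrib,
    Finset.sum_const, Finset.sum_const, Finset.sum_const, ← signSum_eq_sum,
    ← Fintype.card_subtype, ← Fintype.card_subtype, hZ, Finset.card_univ,
    ← Nat.card_eq_fintype_card, ← Nat.card_eq_fintype_card, hG.card] at hsum
  push_cast [nsmul_eq_mul] at hsum
  linarith

theorem card_noncommuting_with_square (hG : IsSpecialOfRank 2 (m + 1) G) {e : G}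
    (he : e ∉ Subgroup.center G) (he2 : e ^ 2 = 1) {w : G} (hw : w ∈ Subgroup.center G) :
    Nat.card {y : G // ⁅e, y⁆ ≠ 1 ∧ y ^ 2 = w} = 2 ^ (1 + 2 * m) := by
  classical
  have := hG.finite Nat.prime_two
  cases nonempty_fintype G
  have hx (y : G) : (if ⁅e, y⁆ ≠ 1 ∧ y ^ 2 = w then (4 : ℤ) else 0) =
      (1 - groupSign ⁅e, y⁆) * (1 + groupSign w * groupSign (y ^ 2)) := by
    by_cases h : ⁅e, y⁆ = 1
    · simp [h, groupSign_one]
    by_cases h' : y ^ 2 = w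
    · simp [h, h', groupSign_ne, groupSign_mul_self]
    have h₁ : groupSign w * groupSign (y ^ 2) = -1 := by
      by_cases hw1 : w = 1
      · rw [hw1] at h' ⊢
        rw [groupSign_ne h', groupSign_one, one_mul]
      by_cases hy1 : y ^ 2 = 1
      · rw [groupSign_ne hw1, hy1, groupSign_one, mul_one]
      exact absurd (hG.eq_of_mem_center (hG.sq_mem_center y) hw hy1 hw1) h'
    simp [h', h₁]
  have hsum := Finset.sum_congr (rfl : (Finset.univ : Finset G) = _) fun x _ => hx x
  have hexp : ∑ y : G, (1 - groupSign ⁅e, y⁆) * (1 + groupSign w * groupSign (y ^ 2)) =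
      ∑ y : G, (1 : ℤ) - ∑ y : G, groupSign ⁅e, y⁆ + groupSign w * (∑ y : G, groupSign (y ^ 2) -
        ∑ y : G, groupSign (y ^ 2) * groupSign ⁅e, y⁆) := by
    simp only [← Finset.sum_sub_distrib, Finset.mul_sum, ← Finset.sum_add_distrib]
    exact Finset.sum_congr rfl fun y _ => by ring
  rw [← Finset.sum_filter, hexp, hG.sum_groupSign_commutator he, hG.sum_sq_mul_commutator he2,
    ← signSum_eq_sum, Finset.sum_const, Finset.sum_const, ← Fintype.card_subtype, Finset.card_univ,
    ← Nat.card_eq_fintype_card, ← Nat.card_eq_fintype_card, hG.card] at hsum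
  push_cast [nsmul_eq_mul] at hsum
  zify
  ring_nf at hsum ⊢
  linarith

theorem card_le_of_involution (hG : IsSpecialOfRank 2 (m + 1) G) {e₁ e₂ : G}
    (h₁ : e₁ ^ 2 = 1) (he : ⁅e₁, e₂⁆ ≠ 1) : Nat.card (centralAutomorphisms G) ≤
      Nat.card {x : G // x ∉ Subgroup.center G ∧ x ^ 2 = 1} * 2 ^ (1 + 2 * m) *
        Nat.card (centralAutomorphisms (Subgroup.centralizer {e₁, e₂})) := by
  classical
  have := hG.finite Nat.prime_two
  cases nonempty_fintype G
  let P : Set (G × G) :=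
    {p | (p.1 ∉ Subgroup.center G ∧ p.1 ^ 2 = 1) ∧ ⁅p.1, p.2⁆ ≠ 1 ∧ p.2 ^ 2 = e₂ ^ 2}
  have e : P ≃ Σ x : {x : G // x ∉ Subgroup.center G ∧ x ^ 2 = 1},
      {y : G // ⁅x.1, y⁆ ≠ 1 ∧ y ^ 2 = e₂ ^ 2} :=
    ⟨fun p => ⟨⟨p.1.1, p.2.1⟩, ⟨p.1.2, p.2.2⟩⟩, fun s => ⟨(s.1.1, s.2.1), s.1.2, s.2.2⟩,
      fun _ => rfl, fun _ => rfl⟩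
  have hP : Nat.card P =
      Nat.card {x : G // x ∉ Subgroup.center G ∧ x ^ 2 = 1} * 2 ^ (1 + 2 * m) := by
    rw [Nat.card_congr e, Nat.card_sigma, Finset.sum_congr rfl fun x _ =>
      hG.card_noncommuting_with_square x.2.1 x.2.2 (hG.sq_mem_center e₂), Finset.sum_const,
      Finset.card_univ, smul_eq_mul, ← Nat.card_eq_fintype_card]
  rw [← hP]
  refine hG.card_le Nat.prime_two he P fun f hf => ⟨⟨fun h => he ?_, ?_⟩, ?_, ?_⟩
  · rw [← hG.map_commutator hf]
    exact commutatorElement_eq_one_iff_mul_comm.mpr (Subgroup.mem_center_iff.mp h _).symm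
  · rw [← map_pow, h₁, map_one]
  · rwa [hG.map_commutator hf]
  · rw [← map_pow]
    exact hf _ (hG.sq_mem_center e₂)

theorem exists_noncentral_involution (hG : IsSpecialOfRank 2 m G)
    (h : 4 < 2 ^ (1 + 2 * m) + signSum G) : ∃ x : G, x ∉ Subgroup.center G ∧ x ^ 2 = 1 := by
  by_contra! hne
  have : IsEmpty {x : G // x ∉ Subgroup.center G ∧ x ^ 2 = 1} := ⟨fun x => hne x.1 x.2.1 x.2.2⟩
  have hc := hG.card_noncentral_involutions
  rw [Nat.card_of_isEmpty] at hc
  push_cast at hc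
  linarith

theorem card_le_of_rank_one (hG : IsSpecialOfRank 2 1 G) :
    Nat.card (centralAutomorphisms G) ≤ 24 := by
  obtain ⟨e₁, h₁⟩ := hG.exists_notMem_center Nat.prime_two
  obtain ⟨e₂, he⟩ := exists_commutator_ne_one h₁
  have h := hG.card_succ_le Nat.prime_two he
  rwa [(hG.centralizer_pair Nat.prime_two he).card_zero Nat.prime_two] at h

theorem card_mulAut_le {q : ℕ} (hG : IsSpecialOfRank q m G) (hq : q.Prime) :
    Nat.card (MulAut G) ≤ (q - 1) * Nat.card (centralAutomorphisms G) := by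
  classical
  have : Fact q.Prime := ⟨hq⟩
  have := hG.finite hq
  have : Finite (MulAut G) := finite_mulAut
  obtain ⟨z, hz⟩ : ∃ z : Subgroup.center G, z ≠ 1 := by
    have : Nontrivial (Subgroup.center G) :=
      Finite.one_lt_card_iff_nontrivial.mp (hG.card_center ▸ hq.one_lt)
    exact exists_ne 1
  have htop := zpowers_eq_top_of_prime_card hG.card_center hz
  rw [← Nat.card_congr (MulAction.orbitProdStabilizerEquivGroup (MulAut G) (z : G)),
    Nat.card_prod]
  refine Nat.mul_le_mul ?_ (Subgroup.card_le_of_le fun f hf x hx => ?_)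
  · have hcard : Nat.card {x : Subgroup.center G // x ≠ 1} = q - 1 := by
      cases nonempty_fintype G
      rw [Nat.card_eq_fintype_card, Fintype.card_subtype_compl, Fintype.card_subtype_eq,
        ← Nat.card_eq_fintype_card, hG.card_center]
    rw [← hcard]
    have hmem (x : MulAction.orbit (MulAut G) (z : G)) :
        (x : G) ∈ Subgroup.center G ∧ (x : G) ≠ 1 := by
      obtain ⟨_, f, rfl⟩ := x
      refine ⟨Subgroup.mem_center_iff.mpr fun g => ?_, fun h => hz ?_⟩
      · obtain ⟨g, rfl⟩ := f.surjective g
        have h := congrArg f (Subgroup.mem_center_iff.mp z.2 g)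
        rwa [map_mul, map_mul] at h
      · exact Subtype.ext (f.injective (Eq.trans h (map_one f).symm))
    refine Nat.card_le_card_of_injective
      (fun x => ⟨⟨x, (hmem x).1⟩, fun h => (hmem x).2 (congrArg Subtype.val h)⟩) fun x y h => ?_
    exact Subtype.ext (congrArg (fun t => (t.1 : G)) h)
  · obtain ⟨k, hk⟩ : (⟨x, hx⟩ : Subgroup.center G) ∈ Subgroup.zpowers z :=
      htop ▸ Subgroup.mem_top _
    have hxk : x = (z : G) ^ k := (congrArg Subtype.val hk).symm
    have hfz : f (z : G) = z := hf
    rw [hxk, map_zpow, hfz]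

theorem card_le_of_signSum_pos (m : ℕ) :
    ∀ (G : Type*) [Group G], IsSpecialOfRank 2 (m + 1) G → signSum G = 2 ^ (m + 2) →
      Nat.card (centralAutomorphisms G) ≤ 2 ^ (2 * (m + 1) ^ 2 + 1) * (2 ^ (m + 1) - 1) := by
  induction m with
  | zero =>
    intro G _ hG hT
    obtain ⟨e₁, h₁, h₂⟩ := hG.exists_noncentral_involution (by rw [hT]; norm_num)
    obtain ⟨e₂, he⟩ := exists_commutator_ne_one h₁
    have h := hG.card_le_of_involution h₂ he
    have hN := hG.card_noncentral_involutions
    rw [(hG.centralizer_pair Nat.prime_two he).card_zero Nat.prime_two] at h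
    rw [hT] at hN
    norm_num at hN h ⊢
    omega
  | succ m ih =>
    intro G _ hG hT
    have hv : (1 : ℤ) ≤ 2 ^ (m + 1) := one_le_pow₀ (by norm_num)
    have hN := hG.card_noncentral_involutions
    obtain ⟨e₁, h₁, h₂⟩ := hG.exists_noncentral_involution (by
      have h₁ : (2 : ℤ) ^ (1 + 2 * (m + 1 + 1)) = 8 * (2 ^ (m + 1)) ^ 2 := by ring
      have h₂ : (2 : ℤ) ^ (m + 1 + 2) = 4 * 2 ^ (m + 1) := by ring
      rw [hT, h₁, h₂]
      nlinarith)
    obtain ⟨e₂, he⟩ := exists_commutator_ne_one h₁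
    have hC := ih _ (hG.centralizer_pair Nat.prime_two he) (by
      have h := hG.signSum_centralizer_pair h₂ he
      rw [hT, pow_succ'] at h
      omega)
    have h := (hG.card_le_of_involution h₂ he).trans (Nat.mul_le_mul_left _ hC)
    refine h.trans ?_
    rw [hT] at hN
    have hN' : (Nat.card {x : G // x ∉ Subgroup.center G ∧ x ^ 2 = 1} : ℤ) =
        2 * (2 * 2 ^ (m + 1) - 1) * (2 ^ (m + 1) + 1) := by
      ring_nf at hN ⊢
      linarith
    zify [Nat.one_le_two_pow]
    rw [hN']
    have hpow : (2 : ℤ) ^ (2 * (m + 1 + 1) ^ 2 + 1) =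
        2 ^ (1 + 2 * (m + 1)) * 2 ^ (2 * (m + 1) ^ 2 + 1) * (2 * (2 ^ (m + 1)) ^ 2) := by ring
    have hK : (0 : ℤ) ≤ 2 ^ (1 + 2 * (m + 1)) * 2 ^ (2 * (m + 1) ^ 2 + 1) := by positivity
    rw [hpow, pow_succ' (2 : ℤ) (m + 1)]
    generalize (2 : ℤ) ^ (m + 1) = v at hv ⊢
    have key : 2 * (2 * v - 1) * (v + 1) * (v - 1) ≤ 2 * v ^ 2 * (2 * v - 1) := by nlinarith
    calc _ = 2 ^ (1 + 2 * (m + 1)) * 2 ^ (2 * (m + 1) ^ 2 + 1) *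
          (2 * (2 * v - 1) * (v + 1) * (v - 1)) := by ring
      _ ≤ _ := mul_le_mul_of_nonneg_left key hK
      _ = _ := by ring

theorem card_le_of_two_le_rank (m : ℕ) :
    ∀ (G : Type*) [Group G], IsSpecialOfRank 2 (m + 2) G →
      Nat.card (centralAutomorphisms G) ≤ 2 ^ (2 * (m + 2) ^ 2 + (m + 2) + 1) := by
  induction m with
  | zero =>
    intro G _ hG
    rcases hG.signSum_eq with hT | hT
    · exact (card_le_of_signSum_pos 1 G hG hT).trans (by norm_num)
    · obtain ⟨e₁, h₁, h₂⟩ := hG.exists_noncentral_involution (by rw [hT]; norm_num)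
      obtain ⟨e₂, he⟩ := exists_commutator_ne_one h₁
      have h := hG.card_le_of_involution h₂ he
      have hC := (hG.centralizer_pair Nat.prime_two he).card_le_of_rank_one
      have hN := hG.card_noncentral_involutions
      rw [hT] at hN
      have hN' : Nat.card {x : G // x ∉ Subgroup.center G ∧ x ^ 2 = 1} = 10 := by
        norm_num at hN
        omega
      rw [hN'] at h
      norm_num at h ⊢
      omega
  | succ m ih =>
    intro G _ hG
    rcases hG.signSum_eq with hT | hT
    · refine (card_le_of_signSum_pos (m + 2) G hG hT).trans ?_
      exact (Nat.mul_le_mul_left _ (Nat.sub_le _ _)).trans_eq (by ring)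
    · have hv : (1 : ℤ) ≤ 2 ^ m := one_le_pow₀ (by norm_num)
      obtain ⟨e₁, h₁, h₂⟩ := hG.exists_noncentral_involution (by
        have h₁ : (2 : ℤ) ^ (1 + 2 * (m + 1 + 2)) = 128 * (2 ^ m) ^ 2 := by ring
        have h₂ : (2 : ℤ) ^ (m + 1 + 2 + 1) = 16 * 2 ^ m := by ring
        rw [hT, h₁, h₂]
        nlinarith)
      obtain ⟨e₂, he⟩ := exists_commutator_ne_one h₁
      have hC := ih _ (hG.centralizer_pair Nat.prime_two he)
      have hN := hG.card_noncentral_involutions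
      rw [hT] at hN
      have hN' : Nat.card {x : G // x ∉ Subgroup.center G ∧ x ^ 2 = 1} ≤ 2 ^ (2 * (m + 3)) := by
        zify
        ring_nf at hN ⊢
        linarith
      calc Nat.card (centralAutomorphisms G)
          ≤ 2 ^ (2 * (m + 3)) * 2 ^ (1 + 2 * (m + 2)) *
            2 ^ (2 * (m + 2) ^ 2 + (m + 2) + 1) :=
            (hG.card_le_of_involution h₂ he).trans
              (Nat.mul_le_mul (Nat.mul_le_mul_right _ hN') hC)
        _ = 2 ^ (2 * (m + 1 + 2) ^ 2 + (m + 1 + 2) + 1) := by ring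

theorem card_le_NBound {q : ℕ} (hG : IsSpecialOfRank q m G) (hq : q.Prime) (hm : 1 ≤ m) :
    (Nat.card (centralAutomorphisms G) : ℝ) ≤ NBound (q ^ m) q := by
  have hd : (1 : ℝ) ≤ ((q ^ m : ℕ) : ℝ) := by exact_mod_cast Nat.one_le_pow _ _ hq.pos
  rw [NBound]
  split_ifs with h₁ h₂
  · have hq3 : 3 ≤ q := lt_of_le_of_ne hq.two_le (Ne.symm h₁)
    have hlog : (m : ℝ) ≤ Real.logb 3 ((q ^ m : ℕ) : ℝ) := by
      rw [Real.le_logb_iff_rpow_le (by norm_num) (by linarith), Real.rpow_natCast]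
      exact_mod_cast Nat.pow_le_pow_left hq3 m
    calc (Nat.card (centralAutomorphisms G) : ℝ) ≤ ((q ^ m : ℕ) : ℝ) ^ (2 * m + 3) := by
          rw [← Nat.cast_pow, ← pow_mul]
          exact_mod_cast card_centralAutomorphisms_le hq m G hG
      _ = ((q ^ m : ℕ) : ℝ) ^ (2 * (m : ℝ) + 3) := by
          rw [← Real.rpow_natCast]
          norm_num
      _ ≤ _ := Real.rpow_le_rpow_of_exponent_le hd (by linarith)
  · obtain rfl : q = 2 := not_not.mp h₁
    obtain ⟨k, rfl⟩ : ∃ k, m = k + 2 := ⟨m - 2, by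
      have : m ≠ 1 := fun h => by simp [h] at h₂
      omega⟩
    have hlog : Real.logb 2 ((2 ^ (k + 2) : ℕ) : ℝ) = (k + 2 : ℕ) := by
      rw [Nat.cast_pow, Nat.cast_ofNat, ← Real.rpow_natCast,
        Real.logb_rpow (by norm_num) (by norm_num)]
    have hexp : (2 : ℝ) * ((k + 2 : ℕ) : ℝ) + 1 = ((2 * (k + 2) + 1 : ℕ) : ℝ) := by push_cast; ring
    rw [hlog, hexp, Real.rpow_natCast]
    calc (Nat.card (centralAutomorphisms G) : ℝ)
        ≤ ((2 ^ (2 * (k + 2) ^ 2 + (k + 2) + 1) : ℕ) : ℝ) := by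
          exact_mod_cast card_le_of_two_le_rank k G hG
      _ = _ := by
        push_cast
        rw [← pow_mul, ← pow_succ']
        congr 1
        ring
  · obtain rfl : q = 2 := not_not.mp h₁
    obtain rfl : m = 1 := by
      by_contra h
      have : 2 ^ 2 ≤ 2 ^ m := Nat.pow_le_pow_right two_pos (by omega)
      omega
    exact_mod_cast hG.card_le_of_rank_one

end IsSpecialOfRank

/-- **Automorphism bounds for extraspecial groups.** If `E` is extraspecial of order
`q^(1+2a)` (`q` prime, `a ≥ 1`) and `d = q^a`, then `|Aut_c(E)| ≤ N(d,q)` and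
`|Aut(E)| ≤ (q−1)·N(d,q)`. -/
theorem stmt8 (q a : ℕ) (hq : q.Prime) (ha : 1 ≤ a) (E : Type*) [Group E]
    (hE : IsExtraspecial q a E) (d : ℕ) (hd : d = q ^ a) :
    (Nat.card (centralAutomorphisms E) : ℝ) ≤ NBound d q ∧
      (Nat.card (MulAut E) : ℝ) ≤ ((q : ℝ) - 1) * NBound d q := by
  obtain ⟨hcard, hcenter, hcomm⟩ := hE
  subst hd
  have hG : IsSpecialOfRank q a E := ⟨hcard, hcenter, fun x y => hcomm ▸
    Subgroup.commutator_mem_commutator (Subgroup.mem_top x) (Subgroup.mem_top y)⟩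
  have hN := hG.card_le_NBound hq ha
  refine ⟨hN, ?_⟩
  have hq1 : ((q - 1 : ℕ) : ℝ) = (q : ℝ) - 1 := by rw [Nat.cast_sub hq.one_le, Nat.cast_one]
  calc (Nat.card (MulAut E) : ℝ) ≤ ((q - 1 : ℕ) : ℝ) * Nat.card (centralAutomorphisms E) := by
        exact_mod_cast hG.card_mulAut_le hq
    _ ≤ ((q - 1 : ℕ) : ℝ) * NBound (q ^ a) q := mul_le_mul_of_nonneg_left hN (Nat.cast_nonneg _)
    _ = _ := by rw [hq1]
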